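/- arXiv:2401.05535 — 3 statements merged into one kernel-verified Lean document; each statement's English description precedes it below -/
import Mathlib

section
/- Let 𝒳 ⊆ ℝ^B be the set of vectors of predictions of the label of an observation by a forest of B trees, and let 𝒴 ⊆ ℝ be bounded, with r = max(|inf 𝒴|, sup 𝒴) and M = sup 𝒴 − inf 𝒴 finite; assume every coordinate of every x ∈ 𝒳 lies in 𝒴 (so ‖x‖_∞ ≤ r) and that |h(x) − y| ≤ M for all relevant h, x, y. Let ℋ_Lasso = {x ∈ 𝒳 ↦ w·x : ‖w‖₁ ≤ Λ, w_j ≥ 0 for all j}, and let S be an i.i.d. sample of size n from a distribution 𝒟 over 𝒳 × 𝒴. Then for any δ ∈ (0, 1), with probability at least 1 − δ, every h ∈ ℋ_Lasso satisfies R(h) ≤ R̂_S(h) + M²·√(log(1/δ)/(2n)) + 4·r·Λ·M·√(2·log(2B)/n), where R and R̂_S are the generalization and empirical risks under the squared loss. -/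
open MeasureTheory

open ProbabilityTheory

theorem abs_integral_le_of_abs_le {X : Type*} [MeasurableSpace X] (D : Measure X)
    [IsProbabilityMeasure D] {f : X → ℝ} {C : ℝ} (h : ∀ x, |f x| ≤ C) : |∫ x, f x ∂D| ≤ C := by
  simpa using norm_integral_le_of_norm_le_const (μ := D) (f := f) (C := C) (ae_of_all _ h)

theorem integral_pi_fin_succ {X : Type*} [MeasurableSpace X] (D : Measure X)
    [IsProbabilityMeasure D] {n : ℕ} (f : (Fin (n + 1) → X) → ℝ) :
    ∫ S, f S ∂(Measure.pi fun _ : Fin (n + 1) => D) =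
      ∫ z : X × (Fin n → X), f (Fin.cons z.1 z.2) ∂(D.prod (Measure.pi fun _ : Fin n => D)) := by
  have h := measurePreserving_piFinSuccAbove (fun _ : Fin (n + 1) => D) 0
  rw [← h.integral_comp (MeasurableEquiv.measurableEmbedding _)]
  refine integral_congr_ae (ae_of_all _ fun S => ?_)
  refine congrArg f ?_
  exact (Fin.cons_self_tail S).symm

theorem measurable_fin_cons {X : Type*} [MeasurableSpace X] {n : ℕ} :
    Measurable fun z : X × (Fin n → X) => (Fin.cons z.1 z.2 : Fin (n + 1) → X) := by
  refine measurable_pi_iff.2 fun i => ?_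
  refine Fin.cases ?_ (fun j => ?_) i
  · simpa using measurable_fst
  · simpa using! (measurable_pi_apply j).comp measurable_snd

/-- Hoeffding's lemma for a function whose oscillation is at most `c`. -/
theorem integral_exp_le_of_oscillation {X : Type*} [MeasurableSpace X] (D : Measure X)
    [IsProbabilityMeasure D] {g : X → ℝ} (hg : Measurable g) {C c : ℝ} (hC : ∀ x, |g x| ≤ C)
    (hc : ∀ x y, g x - g y ≤ c) (s : ℝ) :
    ∫ x, Real.exp (s * g x) ∂D ≤ Real.exp (s * ∫ x, g x ∂D + s ^ 2 * c ^ 2 / 8) := by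
  have hne : Nonempty X := nonempty_of_isProbabilityMeasure D
  have hbdd : BddBelow (Set.range g) := ⟨-C, by rintro _ ⟨x, rfl⟩; exact (abs_le.1 (hC x)).1⟩
  have hmem : ∀ x, g x ∈ Set.Icc (⨅ y, g y) ((⨅ y, g y) + c) := fun x =>
    ⟨ciInf_le hbdd x, by
      have : g x - c ≤ ⨅ y, g y := le_ciInf fun y => by linarith [hc x y]
      linarith⟩
  have h := (hasSubgaussianMGF_of_mem_Icc hg.aemeasurable (ae_of_all D hmem)).mgf_le s
  have hmgf : mgf (fun x => g x - D[g]) D s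
      = Real.exp (-(s * ∫ x, g x ∂D)) * ∫ x, Real.exp (s * g x) ∂D := by
    rw [mgf, ← integral_const_mul]
    refine integral_congr_ae (ae_of_all _ fun x => ?_)
    simp only
    rw [← Real.exp_add]
    congr 1
    ring
  rw [hmgf] at h
  have hcc : ((((‖(⨅ y, g y) + c - ⨅ y, g y‖₊ / 2) ^ 2 : NNReal)) : ℝ) = c ^ 2 / 4 := by
    push_cast
    rw [add_sub_cancel_left, Real.norm_eq_abs, div_pow, sq_abs]
    norm_num
  rw [hcc] at h
  have h2 := mul_le_mul_of_nonneg_left h (Real.exp_pos (s * ∫ x, g x ∂D)).le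
  rw [← mul_assoc, ← Real.exp_add, ← Real.exp_add, add_neg_cancel, Real.exp_zero, one_mul] at h2
  refine h2.trans_eq ?_
  congr 1
  ring

theorem integrable_of_measurable_of_abs_le {X : Type*} [MeasurableSpace X] {D : Measure X}
    [IsFiniteMeasure D] {f : X → ℝ} (hf : Measurable f) {C : ℝ} (h : ∀ x, |f x| ≤ C) :
    Integrable f D :=
  Integrable.of_bound hf.aestronglyMeasurable C (ae_of_all _ h)

theorem integrable_exp_of_abs_le {X : Type*} [MeasurableSpace X] {D : Measure X}
    [IsFiniteMeasure D] {f : X → ℝ} (hf : Measurable f) {C : ℝ} (h : ∀ x, |f x| ≤ C) (s : ℝ) :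
    Integrable (fun x => Real.exp (s * f x)) D := by
  refine integrable_of_measurable_of_abs_le (C := Real.exp (|s| * C)) (by fun_prop) fun x => ?_
  rw [Real.abs_exp, Real.exp_le_exp]
  refine (le_abs_self _).trans ?_
  rw [abs_mul]
  exact mul_le_mul_of_nonneg_left (h x) (abs_nonneg s)

/-- The exponential moment form of McDiarmid's bounded differences inequality. -/
theorem integral_exp_le_of_bounded_differences {X : Type*} [MeasurableSpace X] (D : Measure X)
    [IsProbabilityMeasure D] {c C : ℝ} (s : ℝ) (n : ℕ) (f : (Fin n → X) → ℝ) (hf : Measurable f)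
    (hC : ∀ S, |f S| ≤ C) (hc : ∀ S i x, f S - f (Function.update S i x) ≤ c) :
    ∫ S, Real.exp (s * f S) ∂(Measure.pi fun _ : Fin n => D) ≤
      Real.exp (s * ∫ S, f S ∂(Measure.pi fun _ : Fin n => D) + n * (s ^ 2 * c ^ 2 / 8)) := by
  induction n with
  | zero =>
    have h : ∀ S, f S = f default := fun S => congrArg f (Subsingleton.elim _ _)
    simp [h]
  | succ n ih =>
    set P := Measure.pi fun _ : Fin n => D
    have hF : Measurable fun z : X × (Fin n → X) => f (Fin.cons z.1 z.2) :=
      hf.comp measurable_fin_cons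
    have hFint : Integrable (fun z : X × (Fin n → X) => f (Fin.cons z.1 z.2)) (D.prod P) :=
      integrable_of_measurable_of_abs_le hF fun z => hC _
    have hEint : Integrable (fun z : X × (Fin n → X) => Real.exp (s * f (Fin.cons z.1 z.2)))
        (D.prod P) :=
      integrable_exp_of_abs_le hF (fun z => hC _) s
    set g : X → ℝ := fun x => ∫ S, f (Fin.cons x S) ∂P with hg
    have hgm : Measurable g :=
      (StronglyMeasurable.integral_prod_right (f := fun x S => f (Fin.cons x S))
        hF.stronglyMeasurable).measurable
    have hgC : ∀ x, |g x| ≤ C := fun x => abs_integral_le_of_abs_le P fun S => hC _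
    have hsec : ∀ x, Measurable fun S => f (Fin.cons x S) := fun x =>
      hF.comp measurable_prodMk_left
    have hgc : ∀ x y, g x - g y ≤ c := fun x y => by
      have hi : ∀ x, Integrable (fun S => f (Fin.cons x S)) P := fun x =>
        integrable_of_measurable_of_abs_le (hsec x) fun S => hC _
      rw [hg, ← integral_sub (hi x) (hi y)]
      refine (integral_mono ((hi x).sub (hi y)) (integrable_const c) fun S => ?_).trans_eq (by simp)
      simpa using hc (Fin.cons x S) 0 y
    rw [integral_pi_fin_succ, integral_pi_fin_succ, integral_prod _ hEint, integral_prod _ hFint]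
    have hinner : ∀ x, ∫ S, Real.exp (s * f (Fin.cons x S)) ∂P ≤
        Real.exp (n * (s ^ 2 * c ^ 2 / 8)) * Real.exp (s * g x) := fun x => by
      rw [← Real.exp_add, add_comm (_ * _) (s * g x)]
      refine ih (fun S => f (Fin.cons x S)) (hsec x) (fun S => hC _) fun S i y => ?_
      simpa using hc (Fin.cons x S) i.succ y
    have hgexp : Integrable (fun x => Real.exp (s * g x)) D :=
      integrable_exp_of_abs_le hgm hgC s
    refine (integral_mono hEint.integral_prod_left (hgexp.const_mul _) hinner).trans ?_
    rw [integral_const_mul]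
    refine (mul_le_mul_of_nonneg_left (integral_exp_le_of_oscillation D hgm hgC hgc s)
      (Real.exp_pos _).le).trans_eq ?_
    rw [← Real.exp_add]
    congr 1
    push_cast
    ring

/-- McDiarmid's inequality. -/
theorem one_sub_le_measure_le_of_bounded_differences {X : Type*} [MeasurableSpace X]
    (D : Measure X) [IsProbabilityMeasure D] {c C δ : ℝ} (hc0 : 0 < c) (hδ : δ ∈ Set.Ioo (0 : ℝ) 1)
    {n : ℕ} (hn : 0 < n) {f : (Fin n → X) → ℝ} (hf : Measurable f)
    (hC : ∀ S, |f S| ≤ C) (hc : ∀ S i x, f S - f (Function.update S i x) ≤ c) :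
    1 - ENNReal.ofReal δ ≤ (Measure.pi fun _ : Fin n => D)
      {S | f S ≤ ∫ S, f S ∂(Measure.pi fun _ : Fin n => D) +
        n * (c * Real.sqrt (Real.log (1 / δ) / (2 * n)))} := by
  set P := Measure.pi fun _ : Fin n => D
  set q := Real.sqrt (Real.log (1 / δ) / (2 * n)) with hq
  have hn' : (0 : ℝ) < n := by exact_mod_cast hn
  have hlog : 0 ≤ Real.log (1 / δ) := Real.log_nonneg (by
    rw [le_div_iff₀ hδ.1]; linarith [hδ.2])
  have hq2 : q ^ 2 = Real.log (1 / δ) / (2 * n) := Real.sq_sqrt (by positivity)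
  have hq0 : 0 ≤ q := Real.sqrt_nonneg _
  set s := 4 * q / c
  have hs : 0 ≤ s := by positivity
  have hint : Integrable (fun S => Real.exp (s * f S)) P :=
      integrable_exp_of_abs_le hf hC s
  set t := ∫ S, f S ∂P + n * (c * q) with ht
  have hch := measure_ge_le_exp_mul_mgf (μ := P) (X := f) t hs hint
  have htail : P.real {S | t ≤ f S} ≤ δ := by
    refine hch.trans ?_
    refine (mul_le_mul_of_nonneg_left
      (integral_exp_le_of_bounded_differences D s n f hf hC hc) (Real.exp_pos _).le).trans_eq ?_
    rw [← Real.exp_add]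
    have : -s * t + (s * ∫ S, f S ∂P + n * (s ^ 2 * c ^ 2 / 8)) = - (2 * n * q ^ 2) := by
      rw [ht]
      simp only [s]
      field_simp
      ring
    rw [this, hq2, mul_div_cancel₀ _ (by positivity), one_div, Real.log_inv, neg_neg,
      Real.exp_log hδ.1]
  have hms : MeasurableSet {S | f S ≤ t} := measurableSet_le hf measurable_const
  have hcompl : P {S | f S ≤ t}ᶜ ≤ ENNReal.ofReal δ := by
    rw [← ENNReal.ofReal_toReal (measure_ne_top P _)]
    refine ENNReal.ofReal_le_ofReal ?_
    refine le_trans ?_ htail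
    refine measureReal_mono (fun S hS => ?_)
    simp only [Set.mem_compl_iff, Set.mem_ofPred_eq, not_le] at hS ⊢
    exact hS.le
  have h1 := prob_compl_eq_one_sub (μ := P) hms.compl
  rw [compl_compl] at h1
  rw [h1]
  exact tsub_le_tsub_left hcompl 1

theorem Continuous.ciSup_of_compactSpace {T Z : Type*} [TopologicalSpace T] [CompactSpace T]
    [TopologicalSpace Z] {f : Z → T → ℝ} (hf : Continuous fun q : Z × T => f q.1 q.2) :
    Continuous fun z => ⨆ t, f z t := by
  have h := isCompact_univ.continuous_sSup (f := f) (K := (Set.univ : Set T)) hf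
  simpa only [Set.image_univ, sSup_range] using h

theorem bddAbove_range_of_abs_le {T : Type*} {f : T → ℝ} {C : ℝ} (h : ∀ t, |f t| ≤ C) :
    BddAbove (Set.range f) :=
  ⟨C, by rintro _ ⟨t, rfl⟩; exact (abs_le.1 (h t)).2⟩

theorem abs_ciSup_le_of_abs_le {T : Type*} [Nonempty T] {f : T → ℝ} {C : ℝ}
    (h : ∀ t, |f t| ≤ C) : |⨆ t, f t| ≤ C :=
  abs_le.2 ⟨(abs_le.1 (h (Classical.arbitrary T))).1.trans
      (le_ciSup (bddAbove_range_of_abs_le h) _), ciSup_le fun t => (abs_le.1 (h t)).2⟩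

/-- The contraction principle for one Rademacher sign. -/
theorem ciSup_add_ciSup_le_of_contraction {T : Type*} [Nonempty T] {u φ v : T → ℝ}
    (hφ : ∀ s t, |φ s - φ t| ≤ |v s - v t|) (hp : BddAbove (Set.range fun t => u t + v t))
    (hm : BddAbove (Set.range fun t => u t - v t)) :
    (⨆ t, (u t + φ t)) + (⨆ t, (u t - φ t)) ≤ (⨆ t, (u t + v t)) + ⨆ t, (u t - v t) := by
  refine ciSup_add_ciSup_le fun s t => ?_
  have h1 := (le_abs_self _).trans (hφ s t)
  have a := le_ciSup hp s
  have b := le_ciSup hp t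
  have c := le_ciSup hm s
  have d := le_ciSup hm t
  rcases abs_cases (v s - v t) with ⟨h, -⟩ | ⟨h, -⟩ <;> linarith

/-- One step of the symmetrization and contraction argument. -/
theorem integral_ciSup_le_of_contraction {T X : Type*} [TopologicalSpace T] [CompactSpace T]
    [Nonempty T] [TopologicalSpace X] [SecondCountableTopology X] [MeasurableSpace X]
    [BorelSpace X] (D : Measure X) [IsProbabilityMeasure D] {u : T → ℝ} {l v : T → X → ℝ}
    {Cu Cl Cv : ℝ} (hu : Continuous u) (hl : Continuous fun q : T × X => l q.1 q.2)
    (hm : Continuous fun t => ∫ x, l t x ∂D)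
    (hv : Continuous fun q : T × X => v q.1 q.2) (huC : ∀ t, |u t| ≤ Cu)
    (hlC : ∀ t x, |l t x| ≤ Cl) (hvC : ∀ t x, |v t x| ≤ Cv)
    (hlv : ∀ s t x, |2 * l s x - 2 * l t x| ≤ |v s x - v t x|) :
    ∫ p, ⨆ t, (u t + (∫ x, l t x ∂D - l t p)) ∂D ≤
      ∫ p, 1 / 2 * ((⨆ t, (u t + v t p)) + ⨆ t, (u t - v t p)) ∂D := by
  have hint : ∀ {F : X → T → ℝ} {C : ℝ}, (Continuous fun q : X × T => F q.1 q.2) →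
      (∀ p t, |F p t| ≤ C) → Integrable (fun p => ⨆ t, F p t) D := fun hF hC =>
    integrable_of_measurable_of_abs_le hF.ciSup_of_compactSpace.measurable
      fun p => abs_ciSup_le_of_abs_le (hC p)
  have hl' : Continuous fun q : X × T => l q.2 q.1 := hl.comp continuous_swap
  have hv' : Continuous fun q : X × T => v q.2 q.1 := hv.comp continuous_swap
  have hm' : Continuous fun q : X × T => ∫ x, l q.2 x ∂D := hm.comp continuous_snd
  have hlp : ∀ p t, |u t + 2 * l t p| ≤ Cu + 2 * Cl := fun p t => by
    have h1 := abs_le.1 (huC t)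
    have h2 := abs_le.1 (hlC t p)
    exact abs_le.2 ⟨by linarith, by linarith⟩
  have hln : ∀ p t, |u t - 2 * l t p| ≤ Cu + 2 * Cl := fun p t => by
    have h1 := abs_le.1 (huC t)
    have h2 := abs_le.1 (hlC t p)
    exact abs_le.2 ⟨by linarith, by linarith⟩
  have hvp : ∀ p t, |u t + v t p| ≤ Cu + Cv := fun p t => (abs_add_le _ _).trans
    (add_le_add (huC t) (hvC t p))
  have hvn : ∀ p t, |u t - v t p| ≤ Cu + Cv := fun p t => (abs_sub _ _).trans
    (add_le_add (huC t) (hvC t p))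
  have hmC : ∀ t, |∫ x, l t x ∂D| ≤ Cl := fun t => abs_integral_le_of_abs_le D (hlC t)
  have hdev : ∀ p t, |u t + (∫ x, l t x ∂D - l t p)| ≤ Cu + 2 * Cl := fun p t => by
    have h1 := abs_le.1 (huC t)
    have h2 := abs_le.1 (hlC t p)
    have h3 := abs_le.1 (hmC t)
    exact abs_le.2 ⟨by linarith, by linarith⟩
  have iA := hint (F := fun p t => u t + (∫ x, l t x ∂D - l t p)) (by fun_prop) hdev
  have ip := hint (F := fun p t => u t + 2 * l t p) (by fun_prop) hlp
  have im := hint (F := fun p t => u t - 2 * l t p) (by fun_prop) hln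
  have ivp := hint (F := fun p t => u t + v t p) (by fun_prop) hvp
  have ivm := hint (F := fun p t => u t - v t p) (by fun_prop) hvn
  have hA : ∀ p, ⨆ t, (u t + (∫ x, l t x ∂D - l t p)) ≤
      1 / 2 * (∫ q, (⨆ t, (u t + 2 * l t q)) ∂D + ⨆ t, (u t - 2 * l t p)) := fun p => by
    refine ciSup_le fun t => ?_
    have h1 : u t + 2 * ∫ x, l t x ∂D ≤ ∫ q, (⨆ t, (u t + 2 * l t q)) ∂D := by
      have hlt : Integrable (l t) D := integrable_of_measurable_of_abs_le
        (by fun_prop : Continuous (l t)).measurable (hlC t)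
      have : u t + 2 * ∫ x, l t x ∂D = ∫ x, (u t + 2 * l t x) ∂D := by
        rw [integral_add (integrable_const _) (hlt.const_mul 2), integral_const_mul]
        simp
      rw [this]
      exact integral_mono ((integrable_const _).add (hlt.const_mul 2)) ip fun q =>
        le_ciSup (bddAbove_range_of_abs_le (hlp q)) t
    have h2 := le_ciSup (bddAbove_range_of_abs_le (hln p)) t
    linarith
  refine (integral_mono iA (((integrable_const _).add im).const_mul _) hA).trans ?_
  have heq : ∫ p, 1 / 2 * (∫ q, (⨆ t, (u t + 2 * l t q)) ∂D + ⨆ t, (u t - 2 * l t p)) ∂D =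
      ∫ p, 1 / 2 * ((⨆ t, (u t + 2 * l t p)) + ⨆ t, (u t - 2 * l t p)) ∂D := by
    rw [integral_const_mul, integral_const_mul, integral_add (integrable_const _) im,
      integral_add ip im]
    simp
  refine heq.trans_le ?_
  refine integral_mono ((ip.add im).const_mul _) ((ivp.add ivm).const_mul _) fun p => ?_
  exact mul_le_mul_of_nonneg_left (ciSup_add_ciSup_le_of_contraction (fun s t => hlv s t p)
    (bddAbove_range_of_abs_le (hvp p)) (bddAbove_range_of_abs_le (hvn p))) (by norm_num)

/-- A smooth upper bound for the maximum of `0` and the `k * c j`, shifted by `κ`. -/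
noncomputable def softMax {B : ℕ} (k κ : ℝ) (c : Fin B → ℝ) : ℝ :=
  Real.log (1 + ∑ j, Real.exp (k * c j + κ))

theorem one_add_sum_exp_pos {B : ℕ} (k κ : ℝ) (c : Fin B → ℝ) :
    0 < 1 + ∑ j, Real.exp (k * c j + κ) := by positivity

theorem softMax_nonneg {B : ℕ} (k κ : ℝ) (c : Fin B → ℝ) : 0 ≤ softMax k κ c :=
  Real.log_nonneg (by
    have : 0 ≤ ∑ j, Real.exp (k * c j + κ) := by positivity
    linarith)

theorem mul_le_softMax {B : ℕ} (k : ℝ) (c : Fin B → ℝ) (j : Fin B) : k * c j ≤ softMax k 0 c := by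
  rw [softMax, Real.le_log_iff_exp_le (one_add_sum_exp_pos k 0 c)]
  have := Finset.single_le_sum (f := fun j => Real.exp (k * c j + 0))
    (fun i _ => (Real.exp_pos _).le) (Finset.mem_univ j)
  simp only [add_zero] at this ⊢
  linarith

theorem softMax_add_softMax_sub_le {B : ℕ} {k κ a : ℝ} {c y : Fin B → ℝ} (hy : ∀ j, |y j| ≤ a) :
    softMax k κ (c + y) + softMax k κ (c - y) ≤ 2 * softMax k (κ + k ^ 2 * a ^ 2 / 2) c := by
  have hP := one_add_sum_exp_pos k κ (c + y)
  have hQ := one_add_sum_exp_pos k κ (c - y)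
  have hR := one_add_sum_exp_pos k (κ + k ^ 2 * a ^ 2 / 2) c
  have hterm : ∀ j, Real.exp (k * (c + y) j + κ) + Real.exp (k * (c - y) j + κ) ≤
      2 * Real.exp (k * c j + (κ + k ^ 2 * a ^ 2 / 2)) := fun j => by
    have h1 : Real.exp (k * (c + y) j + κ) + Real.exp (k * (c - y) j + κ) =
        2 * (Real.exp (k * c j + κ) * Real.cosh (k * y j)) := by
      rw [Real.cosh_eq]
      have e1 : k * (c + y) j + κ = (k * c j + κ) + k * y j := by simp; ring
      have e2 : k * (c - y) j + κ = (k * c j + κ) + -(k * y j) := by simp; ring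
      rw [e1, e2, Real.exp_add _ (k * y j), Real.exp_add _ (-(k * y j))]
      ring
    have h2 : (k * y j) ^ 2 ≤ k ^ 2 * a ^ 2 := by
      rw [mul_pow]
      exact mul_le_mul_of_nonneg_left (sq_le_sq' (abs_le.1 (hy j)).1 (abs_le.1 (hy j)).2)
        (sq_nonneg k)
    rw [h1, ← add_assoc, Real.exp_add (k * c j + κ)]
    have h3 : Real.cosh (k * y j) ≤ Real.exp (k ^ 2 * a ^ 2 / 2) :=
      (Real.cosh_le_exp_half_sq _).trans (Real.exp_le_exp.2 (by linarith))
    gcongr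
  have hsum := Finset.sum_le_sum fun j (_ : j ∈ Finset.univ) => hterm j
  rw [Finset.sum_add_distrib, ← Finset.mul_sum] at hsum
  unfold softMax
  rw [← Real.log_mul hP.ne' hQ.ne', ← Nat.cast_ofNat (R := ℝ), ← Real.log_pow]
  refine Real.log_le_log (mul_pos hP hQ) ?_
  set p := ∑ j, Real.exp (k * (c + y) j + κ)
  set q := ∑ j, Real.exp (k * (c - y) j + κ)
  set R := ∑ j, Real.exp (k * c j + (κ + k ^ 2 * a ^ 2 / 2))
  nlinarith [sq_nonneg (p - q)]

/-- The largest deviation between expected and empirical loss, tilted by a linear functional. -/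
noncomputable def supDeviation {B n : ℕ} {T X : Type*} [MeasurableSpace X] (D : Measure X)
    (W : T → Fin B → ℝ) (l : T → X → ℝ) (c : Fin B → ℝ) (S : Fin n → X) : ℝ :=
  ⨆ t, (∑ j, W t j * c j + ∑ i, (∫ x, l t x ∂D - l t (S i)))

theorem abs_tilted_deviation_le {B n : ℕ} {T X : Type*} [MeasurableSpace X] (D : Measure X)
    [IsProbabilityMeasure D] {W : T → Fin B → ℝ} {l : T → X → ℝ} {Λ Cl : ℝ}
    (hW0 : ∀ t j, 0 ≤ W t j) (hW : ∀ t, ∑ j, W t j ≤ Λ) (hlC : ∀ t x, |l t x| ≤ Cl)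
    {c : Fin B → ℝ} {R : ℝ} (hR : 0 ≤ R) (hc : ∀ j, |c j| ≤ R) (S : Fin n → X) (t : T) :
    |∑ j, W t j * c j + ∑ i, (∫ x, l t x ∂D - l t (S i))| ≤ Λ * R + n * (2 * Cl) := by
  refine (abs_add_le _ _).trans (add_le_add ?_ ?_)
  · refine (Finset.abs_sum_le_sum_abs _ _).trans ?_
    refine (Finset.sum_le_sum (g := fun j => W t j * R) fun j _ => ?_).trans ?_
    · rw [abs_mul, abs_of_nonneg (hW0 t j)]
      exact mul_le_mul_of_nonneg_left (hc j) (hW0 t j)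
    · rw [← Finset.sum_mul]
      exact mul_le_mul_of_nonneg_right (hW t) hR
  · refine (Finset.abs_sum_le_sum_abs _ _).trans ?_
    refine (Finset.sum_le_card_nsmul _ _ (2 * Cl) fun i _ => ?_).trans_eq (by simp)
    refine (abs_sub _ _).trans ?_
    linarith [abs_integral_le_of_abs_le D (hlC t), hlC t (S i)]

theorem abs_apply_le_sum_abs {B : ℕ} (c : Fin B → ℝ) (j : Fin B) : |c j| ≤ ∑ i, |c i| :=
  Finset.single_le_sum (f := fun i => |c i|) (fun _ _ => abs_nonneg _) (Finset.mem_univ j)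

theorem continuous_integral_of_abs_le {T X : Type*} [TopologicalSpace T]
    [FirstCountableTopology T] [TopologicalSpace X] [MeasurableSpace X]
    [OpensMeasurableSpace X] (D : Measure X) [IsProbabilityMeasure D]
    {l : T → X → ℝ} {Cl : ℝ} (hl : Continuous fun q : T × X => l q.1 q.2)
    (hlC : ∀ t x, |l t x| ≤ Cl) : Continuous fun t => ∫ x, l t x ∂D :=
  continuous_of_dominated (bound := fun _ => Cl)
    (fun t => (by fun_prop : Continuous (l t)).measurable.aestronglyMeasurable)
    (fun t => ae_of_all _ (hlC t)) (integrable_const _)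
    (ae_of_all _ fun x => by fun_prop)

theorem continuous_supDeviation {B n : ℕ} {T X : Type*} [TopologicalSpace T] [CompactSpace T]
    [TopologicalSpace X] [MeasurableSpace X] (D : Measure X)
    {W : T → Fin B → ℝ} {l : T → X → ℝ} (hWc : Continuous W)
    (hl : Continuous fun q : T × X => l q.1 q.2) (hm : Continuous fun t => ∫ x, l t x ∂D) :
    Continuous fun q : (Fin B → ℝ) × (Fin n → X) => supDeviation D W l q.1 q.2 := by
  refine Continuous.ciSup_of_compactSpace
    (f := fun (q : (Fin B → ℝ) × (Fin n → X)) t =>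
      ∑ j, W t j * q.1 j + ∑ i, (∫ x, l t x ∂D - l t (q.2 i))) ?_
  have h1 : ∀ i, Continuous fun q : ((Fin B → ℝ) × (Fin n → X)) × T => l q.2 (q.1.2 i) :=
    fun _ => hl.comp (continuous_snd.prodMk (by fun_prop))
  have h2 : Continuous fun q : ((Fin B → ℝ) × (Fin n → X)) × T => ∫ x, l q.2 x ∂D :=
    hm.comp continuous_snd
  fun_prop

theorem integral_supDeviation_le {B : ℕ} {T X : Type*} [TopologicalSpace T] [CompactSpace T]
    [Nonempty T] [TopologicalSpace X] [SecondCountableTopology X] [MeasurableSpace X]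
    [BorelSpace X] (D : Measure X) [IsProbabilityMeasure D] {W : T → Fin B → ℝ}
    {l : T → X → ℝ} {f : X → Fin B → ℝ} {Λ Cl a k : ℝ}
    (hWc : Continuous W) (hl : Continuous fun q : T × X => l q.1 q.2)
    (hm : Continuous fun t => ∫ x, l t x ∂D) (hf : Continuous f)
    (hW0 : ∀ t j, 0 ≤ W t j) (hW : ∀ t, ∑ j, W t j ≤ Λ) (hlC : ∀ t x, |l t x| ≤ Cl)
    (ha : 0 ≤ a) (hfa : ∀ x j, |f x j| ≤ a) (hk : 0 < k)
    (hlf : ∀ s t x, |2 * l s x - 2 * l t x| ≤ |∑ j, W s j * f x j - ∑ j, W t j * f x j|)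
    (n : ℕ) (c : Fin B → ℝ) :
    ∫ S, supDeviation D W l c S ∂(Measure.pi fun _ : Fin n => D) ≤
      Λ / k * softMax k (n * (k ^ 2 * a ^ 2 / 2)) c := by
  induction n generalizing c with
  | zero =>
    have hsup : ∀ S : Fin 0 → X, supDeviation D W l c S ≤ Λ / k * softMax k 0 c := fun S => by
      refine ciSup_le fun t => ?_
      have h1 : ∑ j, W t j * c j ≤ ∑ j, W t j * (softMax k 0 c / k) := by
        refine Finset.sum_le_sum fun j _ => mul_le_mul_of_nonneg_left ?_ (hW0 t j)
        rw [le_div_iff₀ hk, mul_comm]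
        exact mul_le_softMax k c j
      rw [← Finset.sum_mul] at h1
      have h2 := mul_le_mul_of_nonneg_right (hW t)
        (div_nonneg (softMax_nonneg k 0 c) hk.le)
      rw [Finset.univ_eq_empty (α := Fin 0), Finset.sum_empty, add_zero]
      refine h1.trans (h2.trans_eq ?_)
      ring
    have h0 : ∀ S : Fin 0 → X, supDeviation D W l c S = supDeviation D W l c default :=
      fun S => congrArg _ (Subsingleton.elim _ _)
    simpa [h0] using hsup default
  | succ n ih =>
    set P := Measure.pi fun _ : Fin n => D
    have hΛ : 0 ≤ Λ :=
      (Finset.sum_nonneg fun j _ => hW0 (Classical.arbitrary T) j).trans (hW _)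
    have hcont : ∀ m : ℕ,
        Continuous fun q : (Fin B → ℝ) × (Fin m → X) => supDeviation D W l q.1 q.2 :=
      fun m => continuous_supDeviation D hWc hl hm
    have hbd : ∀ {m : ℕ} {R : ℝ} (e : Fin B → ℝ), 0 ≤ R → (∀ j, |e j| ≤ R) → ∀ S : Fin m → X,
        |supDeviation D W l e S| ≤ Λ * R + m * (2 * Cl) := fun e hR he S =>
      abs_ciSup_le_of_abs_le fun t => abs_tilted_deviation_le D hW0 hW hlC hR he S t
    have hint0 : Integrable (fun z : X × (Fin n → X) =>
        supDeviation D W l c (Fin.cons z.1 z.2 : Fin (n + 1) → X)) (D.prod P) := by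
      refine integrable_of_measurable_of_abs_le ?_ fun z =>
        hbd c (Finset.sum_nonneg fun i _ => abs_nonneg (c i)) (abs_apply_le_sum_abs c) _
      have hc : Continuous fun S : Fin (n + 1) → X => supDeviation D W l c S :=
        (hcont (n + 1)).comp (by fun_prop : Continuous fun S : Fin (n + 1) → X => (c, S))
      exact hc.measurable.comp measurable_fin_cons
    have hR : 0 ≤ ∑ i, |c i| + a := add_nonneg (Finset.sum_nonneg fun i _ => abs_nonneg (c i)) ha
    have hintp : Integrable (fun z : X × (Fin n → X) =>
        supDeviation D W l (c + f z.1) z.2) (D.prod P) := by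
      refine integrable_of_measurable_of_abs_le ?_ fun z => hbd (c + f z.1) hR (fun j =>
        (abs_add_le _ _).trans (add_le_add (abs_apply_le_sum_abs c j) (hfa z.1 j))) _
      exact ((hcont n).comp (by fun_prop :
        Continuous fun z : X × (Fin n → X) => (c + f z.1, z.2))).measurable
    have hintm : Integrable (fun z : X × (Fin n → X) =>
        supDeviation D W l (c - f z.1) z.2) (D.prod P) := by
      refine integrable_of_measurable_of_abs_le ?_ fun z => hbd (c - f z.1) hR (fun j =>
        (abs_sub _ _).trans (add_le_add (abs_apply_le_sum_abs c j) (hfa z.1 j))) _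
      exact ((hcont n).comp (by fun_prop :
        Continuous fun z : X × (Fin n → X) => (c - f z.1, z.2))).measurable
    have hhalf := (hintp.add hintm).const_mul (1 / 2)
    have hstep : ∀ S : Fin n → X,
        ∫ p, supDeviation D W l c (Fin.cons p S : Fin (n + 1) → X) ∂D ≤
          ∫ p, 1 / 2 * (supDeviation D W l (c + f p) S + supDeviation D W l (c - f p) S) ∂D := by
      intro S
      have h := integral_ciSup_le_of_contraction D
        (u := fun t => ∑ j, W t j * c j + ∑ i, (∫ x, l t x ∂D - l t (S i))) (l := l)
        (v := fun t p => ∑ j, W t j * f p j)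
        (Cu := Λ * ∑ i, |c i| + n * (2 * Cl)) (Cl := Cl) (Cv := Λ * a) (by fun_prop) hl hm
        (by fun_prop)
        (abs_tilted_deviation_le D hW0 hW hlC (Finset.sum_nonneg fun i _ => abs_nonneg (c i))
          (abs_apply_le_sum_abs c) S) hlC
        (fun t p => by
          simpa using abs_tilted_deviation_le D hW0 hW hlC ha (hfa p) (Fin.elim0 : Fin 0 → X) t)
        hlf
      refine (Eq.trans_le ?_ h).trans_eq ?_
      · refine integral_congr_ae (ae_of_all _ fun p => ?_)
        refine iSup_congr fun t => ?_
        rw [Fin.sum_univ_succ]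
        simp only [Fin.cons_zero, Fin.cons_succ]
        ring
      · refine integral_congr_ae (ae_of_all _ fun p => ?_)
        refine congrArg (fun z : ℝ => 1 / 2 * z) (congrArg₂ (· + ·) ?_ ?_)
        · refine iSup_congr fun t => ?_
          simp only [Pi.add_apply, mul_add, Finset.sum_add_distrib]
          ring
        · refine iSup_congr fun t => ?_
          simp only [Pi.sub_apply, mul_sub, Finset.sum_sub_distrib]
          ring
    rw [integral_pi_fin_succ, integral_prod_symm _ hint0]
    refine (integral_mono hint0.integral_prod_right hhalf.integral_prod_right hstep).trans ?_
    refine (integral_prod_symm _ hhalf).symm.trans_le ?_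
    rw [integral_prod _ hhalf]
    refine (integral_mono hhalf.integral_prod_left (integrable_const
      (Λ / k * softMax k (((n + 1 : ℕ) : ℝ) * (k ^ 2 * a ^ 2 / 2)) c)) fun p => ?_).trans_eq
      (by simp)
    have hsp : Integrable (fun S => supDeviation D W l (c + f p) S) P :=
      integrable_of_measurable_of_abs_le ((hcont n).comp (by fun_prop :
        Continuous fun S : Fin n → X => (c + f p, S))).measurable
        (hbd _ (Finset.sum_nonneg fun i _ => abs_nonneg _) (abs_apply_le_sum_abs _))
    have hsm : Integrable (fun S => supDeviation D W l (c - f p) S) P :=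
      integrable_of_measurable_of_abs_le ((hcont n).comp (by fun_prop :
        Continuous fun S : Fin n → X => (c - f p, S))).measurable
        (hbd _ (Finset.sum_nonneg fun i _ => abs_nonneg _) (abs_apply_le_sum_abs _))
    simp only [Pi.add_apply]
    rw [integral_const_mul, integral_add hsp hsm]
    have h1 := ih (c + f p)
    have h2 := ih (c - f p)
    have h3 := mul_le_mul_of_nonneg_left
      (softMax_add_softMax_sub_le (k := k) (κ := n * (k ^ 2 * a ^ 2 / 2)) (c := c) (hfa p))
      (div_nonneg hΛ hk.le)
    have h4 : ((n + 1 : ℕ) : ℝ) * (k ^ 2 * a ^ 2 / 2) =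
        n * (k ^ 2 * a ^ 2 / 2) + k ^ 2 * a ^ 2 / 2 := by push_cast; ring
    rw [h4]
    linarith

/-- The maximal inequality obtained by optimizing the temperature `k`. -/
theorem integral_supDeviation_zero_le {B : ℕ} (hB : 0 < B) {T X : Type*} [TopologicalSpace T]
    [CompactSpace T]
    [Nonempty T] [TopologicalSpace X] [SecondCountableTopology X] [MeasurableSpace X]
    [BorelSpace X] (D : Measure X) [IsProbabilityMeasure D] {W : T → Fin B → ℝ}
    {l : T → X → ℝ} {f : X → Fin B → ℝ} {Λ Cl a : ℝ}
    (hWc : Continuous W) (hl : Continuous fun q : T × X => l q.1 q.2)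
    (hm : Continuous fun t => ∫ x, l t x ∂D) (hf : Continuous f)
    (hW0 : ∀ t j, 0 ≤ W t j) (hW : ∀ t, ∑ j, W t j ≤ Λ) (hlC : ∀ t x, |l t x| ≤ Cl)
    (ha : 0 < a) (hfa : ∀ x j, |f x j| ≤ a)
    (hlf : ∀ s t x, |2 * l s x - 2 * l t x| ≤ |∑ j, W s j * f x j - ∑ j, W t j * f x j|)
    {n : ℕ} (hn : 0 < n) :
    ∫ S, supDeviation D W l 0 S ∂(Measure.pi fun _ : Fin n => D) ≤
      n * (Λ * a * Real.sqrt (2 * Real.log (2 * B) / n)) := by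
  have hΛ : 0 ≤ Λ :=
    (Finset.sum_nonneg fun j _ => hW0 (Classical.arbitrary T) j).trans (hW _)
  have hn' : (0 : ℝ) < n := by exact_mod_cast hn
  have hB' : (1 : ℝ) ≤ B := by exact_mod_cast hB
  have hlog : 0 < Real.log (2 * B) := Real.log_pos (by linarith)
  set q := Real.sqrt (2 * Real.log (2 * B) / n) with hq
  have hq0 : 0 < q := Real.sqrt_pos.2 (by positivity)
  have hq2 : q ^ 2 = 2 * Real.log (2 * B) / n := Real.sq_sqrt (by positivity)
  have hlogq : Real.log (2 * B) = n * q ^ 2 / 2 := by rw [hq2]; field_simp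
  have hk : 0 < q / a := by positivity
  refine (integral_supDeviation_le D hWc hl hm hf hW0 hW hlC ha.le hfa hk hlf n 0).trans ?_
  have hka : n * ((q / a) ^ 2 * a ^ 2 / 2) = n * q ^ 2 / 2 := by field_simp
  have hsoft : softMax (q / a) (n * ((q / a) ^ 2 * a ^ 2 / 2)) (0 : Fin B → ℝ) ≤ n * q ^ 2 := by
    rw [hka, softMax]
    simp only [Pi.zero_apply, mul_zero, zero_add, Finset.sum_const, Finset.card_univ,
      Fintype.card_fin, nsmul_eq_mul]
    have h1 : 1 ≤ Real.exp (n * q ^ 2 / 2) := Real.one_le_exp (by positivity)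
    have h2 : 1 + B * Real.exp (n * q ^ 2 / 2) ≤ 2 * B * Real.exp (n * q ^ 2 / 2) := by
      nlinarith
    refine (Real.log_le_log (by positivity) h2).trans_eq ?_
    rw [Real.log_mul (by positivity) (by positivity), Real.log_exp, hlogq]
    ring
  refine (mul_le_mul_of_nonneg_left hsoft (div_nonneg hΛ hk.le)).trans_eq ?_
  field_simp

theorem supDeviation_sub_update_le {B n : ℕ} {T X : Type*} [Nonempty T] [MeasurableSpace X]
    (D : Measure X) [IsProbabilityMeasure D] {W : T → Fin B → ℝ} {l : T → X → ℝ} {Λ C : ℝ}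
    (hW0 : ∀ t j, 0 ≤ W t j) (hW : ∀ t, ∑ j, W t j ≤ Λ) (hl0 : ∀ t x, 0 ≤ l t x)
    (hlC : ∀ t x, l t x ≤ C) (S : Fin n → X) (i : Fin n) (x : X) :
    supDeviation D W l 0 S - supDeviation D W l 0 (Function.update S i x) ≤ C := by
  rw [sub_le_iff_le_add']
  refine ciSup_le fun t => ?_
  have habs : ∀ t x, |l t x| ≤ C := fun t x => by rw [abs_of_nonneg (hl0 t x)]; exact hlC t x
  have h1 := le_ciSup (bddAbove_range_of_abs_le
    (abs_tilted_deviation_le D hW0 hW habs le_rfl (c := 0) (by simp)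
      (Function.update S i x))) t
  refine le_trans ?_ (add_le_add_left h1 C)
  rw [add_assoc]
  refine add_le_add_right ?_ _
  rw [← Finset.add_sum_erase _ _ (Finset.mem_univ i),
    ← Finset.add_sum_erase (a := i) _ (fun j => ∫ x, l t x ∂D - l t (Function.update S i x j))
      (Finset.mem_univ i)]
  have h2 : ∑ j ∈ Finset.univ.erase i, (∫ x, l t x ∂D - l t (Function.update S i x j)) =
      ∑ j ∈ Finset.univ.erase i, (∫ x, l t x ∂D - l t (S j)) :=
    Finset.sum_congr rfl fun j hj => by rw [Function.update_of_ne (Finset.ne_of_mem_erase hj)]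
  rw [h2, Function.update_self]
  linarith [hl0 t (S i), hlC t x]

/-- Truncation of a real number to `[-r, r]`. -/
noncomputable def truncate (r x : ℝ) : ℝ := max (-r) (min x r)

theorem truncate_of_abs_le {r x : ℝ} (h : |x| ≤ r) : truncate r x = x := by
  rw [truncate, min_eq_left (abs_le.1 h).2, max_eq_right (abs_le.1 h).1]

theorem abs_truncate_le {r : ℝ} (hr : 0 ≤ r) (x : ℝ) : |truncate r x| ≤ r :=
  abs_le.2 ⟨le_max_left _ _, max_le (by linarith) (min_le_right _ _)⟩

theorem continuous_truncate (r : ℝ) : Continuous (truncate r) := by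
  unfold truncate
  fun_prop

theorem abs_truncate_sub_truncate_le (r x y : ℝ) : |truncate r x - truncate r y| ≤ |x - y| := by
  unfold truncate
  refine (abs_max_sub_max_le_max _ _ _ _).trans ?_
  rw [sub_self, abs_zero, max_eq_right (abs_nonneg _)]
  refine (abs_min_sub_min_le_max _ _ _ _).trans ?_
  rw [sub_self, abs_zero, max_eq_left (abs_nonneg _)]

theorem abs_truncate_sq_sub_truncate_sq_le {M : ℝ} (hM : 0 ≤ M) (x y : ℝ) :
    |truncate M x ^ 2 - truncate M y ^ 2| ≤ 2 * M * |x - y| := by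
  rw [sq_sub_sq, abs_mul]
  refine mul_le_mul ?_ (abs_truncate_sub_truncate_le M x y) (abs_nonneg _) (by positivity)
  refine (abs_add_le _ _).trans ?_
  linarith [abs_truncate_le hM x, abs_truncate_le hM y]

theorem isCompact_nonneg_sum_abs_le (B : ℕ) (Λ : ℝ) :
    IsCompact {w : Fin B → ℝ | (∀ j, 0 ≤ w j) ∧ ∑ j, |w j| ≤ Λ} := by
  refine (isCompact_univ_pi fun _ : Fin B => isCompact_Icc (a := (0 : ℝ)) (b := Λ)).of_isClosed_subset
    ?_ ?_
  · refine IsClosed.inter ?_ ?_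
    · have : {w : Fin B → ℝ | ∀ j, 0 ≤ w j} = ⋂ j, {w | 0 ≤ w j} := by ext; simp
      change IsClosed {w : Fin B → ℝ | ∀ j, 0 ≤ w j}
      rw [this]
      exact isClosed_iInter fun j => isClosed_le continuous_const (continuous_apply j)
    · exact isClosed_le
        (by fun_prop : Continuous fun w : Fin B → ℝ => ∑ j, |w j|) continuous_const
  · rintro w ⟨h0, h1⟩ j -
    exact ⟨h0 j, (le_abs_self _).trans ((abs_apply_le_sum_abs w j).trans h1)⟩


/-- generalization bound for Lasso-pruned regression forests.  The hypothesis
class is `ℋ_Lasso = {x ↦ w·x : ‖w‖₁ ≤ Λ, w ≥ 0}` on prediction vectors `x ∈ ℝ^B` whose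
coordinates lie in the bounded label set `𝒴`, with `r = max(|inf 𝒴|, sup 𝒴)` and
`M = sup 𝒴 − inf 𝒴`.  For any `δ ∈ (0,1)`, with probability at least `1 − δ` over the
i.i.d. sample of size `n` from `D`, every `h ∈ ℋ_Lasso` satisfies
`R(h) ≤ R̂_S(h) + M²√(log(1/δ)/(2n)) + 4rΛM√(2 log(2B)/n)`. -/
theorem stmt3 (B n : ℕ) (hB : 0 < B) (hn : 0 < n)
    (𝒴 : Set ℝ) (hYne : 𝒴.Nonempty) (hbddA : BddAbove 𝒴) (hbddB : BddBelow 𝒴)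
    (r M Λ : ℝ) (hΛ : 0 < Λ)
    (hr : r = max |sInf 𝒴| (sSup 𝒴)) (hM : M = sSup 𝒴 - sInf 𝒴)
    (D : Measure ((Fin B → ℝ) × ℝ)) [IsProbabilityMeasure D]
    (hD : ∀ᵐ p ∂D, p.2 ∈ 𝒴 ∧ ∀ j, p.1 j ∈ 𝒴)
    (hloss : ∀ᵐ p ∂D, ∀ w : Fin B → ℝ, (∀ j, 0 ≤ w j) → ∑ j, |w j| ≤ Λ →
      |∑ j, w j * p.1 j - p.2| ≤ M)
    (δ : ℝ) (hδ : δ ∈ Set.Ioo (0 : ℝ) 1) :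
    1 - ENNReal.ofReal δ ≤
      (Measure.pi fun _ : Fin n => D) {S : Fin n → (Fin B → ℝ) × ℝ |
        ∀ w : Fin B → ℝ, (∀ j, 0 ≤ w j) → ∑ j, |w j| ≤ Λ →
          ∫ p, (∑ j, w j * p.1 j - p.2) ^ 2 ∂D ≤
            (n : ℝ)⁻¹ * ∑ i, (∑ j, w j * (S i).1 j - (S i).2) ^ 2 +
              M ^ 2 * Real.sqrt (Real.log (1 / δ) / (2 * n)) +
              4 * r * Λ * M * Real.sqrt (2 * Real.log (2 * B) / n)} := by
  have hM0 : 0 ≤ M := by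
    rw [hM, sub_nonneg]
    exact csInf_le_csSup hYne hbddB hbddA
  have hmemY : ∀ y ∈ 𝒴, |y| ≤ r := fun y hy => by
    have h1 := csInf_le hbddB hy
    have h2 := le_csSup hbddA hy
    have h3 := neg_abs_le (sInf 𝒴)
    have h4 := le_max_left |sInf 𝒴| (sSup 𝒴)
    have h5 := le_max_right |sInf 𝒴| (sSup 𝒴)
    rw [hr, abs_le]
    constructor <;> linarith
  have hr0 : 0 ≤ r := (abs_nonneg _).trans (hmemY _ hYne.some_mem)
  have hn' : (0 : ℝ) < n := by exact_mod_cast hn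
  rcases hM0.eq_or_lt with hMz | hMpos
  · refine tsub_le_self.trans ?_
    rw [← measure_univ (μ := Measure.pi fun _ : Fin n => D)]
    refine measure_mono ?_
    intro S _ w hw0 hw
    have hz : ∫ p, (∑ j, w j * p.1 j - p.2) ^ 2 ∂D = 0 := by
      refine integral_eq_zero_of_ae ?_
      filter_upwards [hloss] with p hp
      have := hp w hw0 hw
      rw [← hMz, abs_nonpos_iff] at this
      simp [this]
    rw [hz, ← hMz]
    have : 0 ≤ (n : ℝ)⁻¹ * ∑ i, (∑ j, w j * (S i).1 j - (S i).2) ^ 2 := by positivity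
    simpa using this
  have hrpos : 0 < r := by
    have h1 : sSup 𝒴 ≤ r := hr ▸ le_max_right _ _
    have h2 : |sInf 𝒴| ≤ r := hr ▸ le_max_left _ _
    have h3 := neg_abs_le (sInf 𝒴)
    linarith
  set K : Set (Fin B → ℝ) := {w | (∀ j, 0 ≤ w j) ∧ ∑ j, |w j| ≤ Λ} with hK
  have : CompactSpace K := isCompact_iff_compactSpace.1 (isCompact_nonneg_sum_abs_le B Λ)
  have : Nonempty K := ⟨⟨0, by simp, by simpa using hΛ.le⟩⟩
  set W : K → Fin B → ℝ := Subtype.val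
  set l : K → (Fin B → ℝ) × ℝ → ℝ := fun w p =>
    truncate M (∑ j, W w j * truncate r (p.1 j) - p.2) ^ 2
  set f : (Fin B → ℝ) × ℝ → Fin B → ℝ := fun p j => 4 * M * truncate r (p.1 j)
  have hW0 : ∀ w j, 0 ≤ W w j := fun w => w.2.1
  have hW : ∀ w, ∑ j, W w j ≤ Λ := fun w =>
    (Finset.sum_le_sum fun j _ => le_abs_self _).trans w.2.2
  have hWc : Continuous W := continuous_subtype_val
  have htr := continuous_truncate r
  have htM := continuous_truncate M
  have hlc : Continuous fun q : K × ((Fin B → ℝ) × ℝ) => l q.1 q.2 := by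
    simp only [l]
    fun_prop
  have hl0 : ∀ w p, 0 ≤ l w p := fun w p => sq_nonneg _
  have hlM : ∀ w p, l w p ≤ M ^ 2 := fun w p => by
    have h := abs_le.1 (abs_truncate_le hM0 (∑ j, W w j * truncate r (p.1 j) - p.2))
    exact sq_le_sq' h.1 h.2
  have hlC : ∀ w p, |l w p| ≤ M ^ 2 := fun w p => by
    rw [abs_of_nonneg (hl0 w p)]
    exact hlM w p
  have hm := continuous_integral_of_abs_le D hlc hlC
  have hf : Continuous f := by
    simp only [f]
    fun_prop
  have hfa : ∀ p j, |f p j| ≤ 4 * M * r := fun p j => by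
    rw [abs_mul, abs_of_pos (by positivity : 0 < 4 * M)]
    exact mul_le_mul_of_nonneg_left (abs_truncate_le hr0 _) (by positivity)
  have hlf : ∀ s t p, |2 * l s p - 2 * l t p| ≤
      |∑ j, W s j * f p j - ∑ j, W t j * f p j| := fun s t p => by
    have h1 : ∀ s, ∑ j, W s j * f p j = 4 * M * ∑ j, W s j * truncate r (p.1 j) := fun s => by
      rw [Finset.mul_sum]
      exact Finset.sum_congr rfl fun j _ => by simp only [f]; ring
    rw [h1, h1, ← mul_sub, ← mul_sub, abs_mul, abs_mul, abs_of_pos (by positivity : 0 < 4 * M),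
      abs_two]
    have h2 := abs_truncate_sq_sub_truncate_sq_le hM0
      (∑ j, W s j * truncate r (p.1 j) - p.2) (∑ j, W t j * truncate r (p.1 j) - p.2)
    rw [sub_sub_sub_cancel_right] at h2
    simp only [l]
    linarith
  have hmean := integral_supDeviation_zero_le hB D hWc hlc hm hf hW0 hW hlC
    (by positivity : 0 < 4 * M * r) hfa hlf hn
  have hmeas : Measurable fun S : Fin n → (Fin B → ℝ) × ℝ => supDeviation D W l 0 S :=
    ((continuous_supDeviation D hWc hlc hm).comp (by fun_prop :
      Continuous fun S : Fin n → (Fin B → ℝ) × ℝ => ((0 : Fin B → ℝ), S))).measurable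
  have hconc := one_sub_le_measure_le_of_bounded_differences D (pow_pos hMpos 2) hδ hn hmeas
    (fun S => abs_ciSup_le_of_abs_le
      (abs_tilted_deviation_le D hW0 hW hlC le_rfl (c := 0) (by simp) S))
    (supDeviation_sub_update_le D hW0 hW hl0 hlM)
  have hgood : ∀ᵐ p ∂D, ∀ w : K, l w p = (∑ j, W w j * p.1 j - p.2) ^ 2 := by
    filter_upwards [hD, hloss] with p hp hq w
    simp only [l]
    rw [Finset.sum_congr rfl fun j _ => by rw [truncate_of_abs_le (hmemY _ (hp.2 j))],
      truncate_of_abs_le (hq w w.2.1 w.2.2)]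
  have hgoodS : ∀ᵐ S ∂(Measure.pi fun _ : Fin n => D), ∀ i, ∀ w : K,
      l w (S i) = (∑ j, W w j * (S i).1 j - (S i).2) ^ 2 :=
    ae_all_iff.2 fun i =>
      (Measure.tendsto_eval_ae_ae (μ := fun _ : Fin n => D) (i := i)).eventually hgood
  refine hconc.trans (measure_mono_ae ?_)
  filter_upwards [hgoodS] with S hS hdev w hw0 hw
  have hdev' : supDeviation D W l 0 S ≤ _ := hdev
  have h1 := (le_ciSup (bddAbove_range_of_abs_le
    (abs_tilted_deviation_le D hW0 hW hlC le_rfl (c := 0) (by simp) S)) ⟨w, hw0, hw⟩).trans hdev'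
  have h2 : ∫ p, l ⟨w, hw0, hw⟩ p ∂D = ∫ p, (∑ j, w j * p.1 j - p.2) ^ 2 ∂D :=
    integral_congr_ae (by filter_upwards [hgood] with p hp using hp ⟨w, hw0, hw⟩)
  have h3 : ∑ i, l ⟨w, hw0, hw⟩ (S i) = ∑ i, (∑ j, w j * (S i).1 j - (S i).2) ^ 2 :=
    Finset.sum_congr rfl fun i _ => hS i ⟨w, hw0, hw⟩
  simp only [Pi.zero_apply, mul_zero, Finset.sum_const_zero, zero_add, Finset.sum_sub_distrib,
    Finset.sum_const, Finset.card_univ, Fintype.card_fin, nsmul_eq_mul, h2, h3] at h1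
  refine le_of_mul_le_mul_left ?_ hn'
  rw [mul_add, mul_add, ← mul_assoc (n : ℝ) (n : ℝ)⁻¹, mul_inv_cancel₀ hn'.ne', one_mul]
  linarith
end

section
/- Let 𝒳 ⊆ ℝ^B be the set of vectors of predictions of the label of an observation by a forest of B trees, 𝒴 ⊆ ℝ bounded with M = sup 𝒴 − inf 𝒴 finite, and assume |h(x) − y| ≤ M for all relevant h, x, y. Fix an integer K with 1 ≤ K ≤ B/2, and let ℋ_BSF = {x ∈ 𝒳 ↦ w·(e·x) : w ∈ {1, 1/2, …, 1/K}, e ∈ {0,1}^B, Σ_{i=1}^B e_i = 1/w} (averages over at most K selected trees). Let S be an i.i.d. sample of size n from a distribution 𝒟 over 𝒳 × 𝒴. Then for any δ > 0, with probability at least 1 − δ, every h ∈ ℋ_BSF satisfies R(h) ≤ R̂_S(h) + M²·√((K·log B + log(1/(δ·(K−1)!)))/(2n)), where R and R̂_S are the generalization and empirical risks under the squared loss. -/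
open MeasureTheory

/-- **Hoeffding's inequality** for the empirical mean of an i.i.d. sample of a function with values
in `[0, b]`. -/
lemma measure_add_lt_integral_le_exp {α : Type*} [MeasurableSpace α] (D : Measure α)
    [IsProbabilityMeasure D] {f : α → ℝ} (hf : Measurable f) {b : ℝ} (hb : 0 < b)
    (hfb : ∀ᵐ p ∂D, f p ∈ Set.Icc 0 b) {n : ℕ} (hn : 0 < n) {t : ℝ} (ht : 0 ≤ t) :
    (Measure.pi fun _ : Fin n => D)
      {S | (n : ℝ)⁻¹ * ∑ i, f (S i) + b * t < ∫ p, f p ∂D} ≤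
        ENNReal.ofReal (Real.exp (-(2 * n * t ^ 2))) := by
  have hn' : (0 : ℝ) < n := by exact_mod_cast hn
  have hsub : ProbabilityTheory.HasSubgaussianMGF (fun p => ∫ q, f q ∂D - f p)
      ((‖b - 0‖₊ / 2) ^ 2) D := by
    refine (ProbabilityTheory.hasSubgaussianMGF_of_mem_Icc hf.aemeasurable hfb).neg.congr ?_
    filter_upwards with p
    simp
  have hind : ProbabilityTheory.iIndepFun
      (fun (i : Fin n) (S : Fin n → α) => ∫ q, f q ∂D - f (S i))
      (Measure.pi fun _ : Fin n => D) :=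
    ProbabilityTheory.iIndepFun_pi (X := fun _ p => ∫ q, f q ∂D - f p)
      fun _ => (measurable_const.sub hf).aemeasurable
  have hsubi : ∀ i ∈ (Finset.univ : Finset (Fin n)), ProbabilityTheory.HasSubgaussianMGF
      (fun S : Fin n → α => ∫ q, f q ∂D - f (S i)) ((‖b - 0‖₊ / 2) ^ 2)
      (Measure.pi fun _ : Fin n => D) := by
    intro i _
    have hmp := measurePreserving_eval (fun _ : Fin n => D) i
    rw [← hmp.map_eq] at hsub
    have := hsub.of_map hmp.measurable.aemeasurable
    rwa [hmp.map_eq] at this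
  have key := ProbabilityTheory.HasSubgaussianMGF.measure_sum_ge_le_of_iIndepFun hind hsubi
    (ε := n * (b * t)) (by positivity)
  have hexp : -((n : ℝ) * (b * t)) ^ 2 /
      (2 * ((∑ _i : Fin n, (‖b - 0‖₊ / 2) ^ 2 : NNReal) : ℝ)) = -(2 * n * t ^ 2) := by
    simp [abs_of_pos hb]
    field_simp
  calc _ ≤ (Measure.pi fun _ : Fin n => D)
        {S | n * (b * t) ≤ ∑ i, (∫ q, f q ∂D - f (S i))} := by
        refine measure_mono fun S hS => ?_
        simp only [Set.mem_ofPred_eq, Finset.sum_sub_distrib, Finset.sum_const, Finset.card_univ,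
          Fintype.card_fin, nsmul_eq_mul] at hS ⊢
        have h := mul_le_mul_of_nonneg_left hS.le hn'.le
        rw [mul_add, mul_inv_cancel_left₀ hn'.ne'] at h
        linarith
    _ ≤ _ := by
        rw [← ofReal_measureReal]
        refine ENNReal.ofReal_le_ofReal (key.trans (le_of_eq ?_))
        rw [← hexp]

lemma Nat.choose_le_choose_of_le_half {n r k : ℕ} (hrk : r ≤ k) (hk : k ≤ n / 2) :
    n.choose r ≤ n.choose k := by
  induction k, hrk using Nat.le_induction with
  | base => exact le_rfl
  | succ m _ ih =>
    exact (ih (by omega)).trans (Nat.choose_le_succ_of_lt_half_left (by omega))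

/-- There are at most `B ^ K / (K - 1)!` nonempty subsets of cardinality at most `K ≤ B / 2`. -/
lemma card_nonempty_card_le_le_pow_div {B K : ℕ} (hK : 1 ≤ K) (hKB : 2 * K ≤ B) :
    ((Finset.univ.filter fun s : Finset (Fin B) => s.Nonempty ∧ s.card ≤ K).card : ℝ) ≤
      (B : ℝ) ^ K / (K - 1).factorial := by
  have hsub : (Finset.univ.filter fun s : Finset (Fin B) => s.Nonempty ∧ s.card ≤ K) ⊆
      (Finset.Icc 1 K).biUnion fun k => Finset.powersetCard k Finset.univ := by
    intro s hs
    simp only [Finset.mem_filter, Finset.mem_univ, true_and] at hs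
    simpa [Finset.mem_powersetCard, Nat.one_le_iff_ne_zero, hs.1.ne_empty] using hs.2
  have hcard : (Finset.univ.filter fun s : Finset (Fin B) => s.Nonempty ∧ s.card ≤ K).card ≤
      K * B.choose K := by
    calc _ ≤ ∑ k ∈ Finset.Icc 1 K, B.choose k := by
          refine (Finset.card_le_card hsub).trans (Finset.card_biUnion_le.trans ?_)
          simp
      _ ≤ ∑ _k ∈ Finset.Icc 1 K, B.choose K :=
          Finset.sum_le_sum fun k hk =>
            Nat.choose_le_choose_of_le_half (Finset.mem_Icc.1 hk).2 (by omega)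
      _ = K * B.choose K := by simp
  calc _ ≤ (K : ℝ) * B.choose K := by exact_mod_cast hcard
    _ ≤ K * ((B : ℝ) ^ K / K.factorial) := by
        gcongr
        exact Nat.choose_le_pow_div K B
    _ = _ := by
        obtain ⟨k, rfl⟩ : ∃ k, K = k + 1 := ⟨K - 1, by omega⟩
        rw [Nat.factorial_succ]
        push_cast
        field_simp


open MeasureTheory

/-- generalization bound for BSF-pruned regression forests.  The hypothesis class
consists of the equally weighted averages over nonempty subsets `s` of at most `K` of the `B`
trees, `x ↦ (1/|s|)∑_{i∈s} x_i`.  With labels in a bounded set `𝒴` of diameter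
`M = sup 𝒴 − inf 𝒴` and squared losses bounded by `M²`, for any `δ > 0`, with probability
at least `1 − δ` over the i.i.d. sample of size `n`, every such hypothesis satisfies
`R(h) ≤ R̂_S(h) + M²√((K log B + log(1/(δ(K−1)!)))/(2n))`. -/
theorem stmt5 (B K n : ℕ) (hK : 1 ≤ K) (hKB : 2 * K ≤ B) (hn : 0 < n)
    (𝒴 : Set ℝ) (hYne : 𝒴.Nonempty) (hbddA : BddAbove 𝒴) (hbddB : BddBelow 𝒴)
    (M : ℝ) (hM : M = sSup 𝒴 - sInf 𝒴)
    (D : Measure ((Fin B → ℝ) × ℝ)) [IsProbabilityMeasure D]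
    (hDY : ∀ᵐ p ∂D, p.2 ∈ 𝒴)
    (hbound : ∀ᵐ p ∂D, ∀ s : Finset (Fin B), s.Nonempty → s.card ≤ K →
      |(s.card : ℝ)⁻¹ * ∑ i ∈ s, p.1 i - p.2| ≤ M)
    (δ : ℝ) (hδ : 0 < δ) :
    1 - ENNReal.ofReal δ ≤
      (Measure.pi fun _ : Fin n => D) {S : Fin n → (Fin B → ℝ) × ℝ |
        ∀ s : Finset (Fin B), s.Nonempty → s.card ≤ K →
          ∫ p, ((s.card : ℝ)⁻¹ * ∑ i ∈ s, p.1 i - p.2) ^ 2 ∂D ≤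
            (n : ℝ)⁻¹ * ∑ i, ((s.card : ℝ)⁻¹ * ∑ j ∈ s, (S i).1 j - (S i).2) ^ 2 +
              M ^ 2 * Real.sqrt
                ((K * Real.log B + Real.log (1 / (δ * (Nat.factorial (K - 1))))) / (2 * n))} := by
  set f : Finset (Fin B) → (Fin B → ℝ) × ℝ → ℝ :=
    fun s p => ((s.card : ℝ)⁻¹ * ∑ i ∈ s, p.1 i - p.2) ^ 2 with hf
  set t : ℝ := Real.sqrt
    ((K * Real.log B + Real.log (1 / (δ * (Nat.factorial (K - 1))))) / (2 * n)) with ht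
  set T : Finset (Finset (Fin B)) :=
    Finset.univ.filter fun s : Finset (Fin B) => s.Nonempty ∧ s.card ≤ K with hT
  have hB : (0 : ℝ) < B := by exact_mod_cast (by omega : 0 < B)
  have hn' : (0 : ℝ) < n := by exact_mod_cast hn
  have hfac : (0 : ℝ) < (K - 1).factorial := by exact_mod_cast Nat.factorial_pos _
  have hfm : ∀ s, Measurable (f s) := fun s => by fun_prop
  have hM0 : 0 ≤ M := hM ▸ sub_nonneg.2 (csInf_le_csSup hYne hbddB hbddA)
  have hfM : ∀ s ∈ T, ∀ᵐ p ∂D, f s p ∈ Set.Icc 0 (M ^ 2) := by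
    intro s hs
    simp only [hT, Finset.mem_filter, Finset.mem_univ, true_and] at hs
    filter_upwards [hbound] with p hp
    exact ⟨sq_nonneg _, sq_le_sq' (abs_le.1 (hp s hs.1 hs.2)).1 (abs_le.1 (hp s hs.1 hs.2)).2⟩
  rcases le_or_gt 1 δ with hδ1 | hδ1
  · rw [tsub_eq_zero_of_le (by simpa using hδ1)]
    exact zero_le
  have hTcard := card_nonempty_card_le_le_pow_div hK hKB
  have hT1 : (1 : ℝ) ≤ T.card := by
    have : (T : Finset (Finset (Fin B))).Nonempty :=
      ⟨{⟨0, by omega⟩}, by simp [hT, hK]⟩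
    exact_mod_cast this.card_pos
  have hlog : K * Real.log B + Real.log (1 / (δ * (Nat.factorial (K - 1)))) =
      Real.log ((B : ℝ) ^ K / (K - 1).factorial / δ) := by
    rw [← Real.log_pow, ← Real.log_mul (by positivity) (by positivity)]
    congr 1
    field_simp
  have hlog0 : 0 ≤ Real.log ((B : ℝ) ^ K / (K - 1).factorial / δ) := by
    refine Real.log_nonneg ((one_le_div hδ).2 ?_)
    linarith
  have hexp : Real.exp (-(2 * n * t ^ 2)) = δ / ((B : ℝ) ^ K / (K - 1).factorial) := by
    rw [ht, hlog, Real.sq_sqrt (by positivity), mul_div_cancel₀ _ (by positivity), Real.exp_neg,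
      Real.exp_log (by positivity), inv_div]
  have hbad : ∀ s ∈ T, (Measure.pi fun _ : Fin n => D)
      {S | (n : ℝ)⁻¹ * ∑ i, f s (S i) + M ^ 2 * t < ∫ p, f s p ∂D} ≤
        ENNReal.ofReal (δ / ((B : ℝ) ^ K / (K - 1).factorial)) := by
    intro s hs
    rcases hM0.eq_or_lt with h0 | hpos
    · have hint : ∫ p, f s p ∂D = 0 := by
        refine integral_eq_zero_of_ae ?_
        filter_upwards [hfM s hs] with p hp
        simpa [← h0] using le_antisymm hp.2 (by simpa [← h0] using hp.1)
      have hempty : {S : Fin n → (Fin B → ℝ) × ℝ |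
          (n : ℝ)⁻¹ * ∑ i, f s (S i) + M ^ 2 * t < ∫ p, f s p ∂D} = ∅ := by
        refine Set.eq_empty_of_forall_notMem fun S hS => ?_
        rw [Set.mem_ofPred_eq, hint] at hS
        exact hS.not_ge (by positivity)
      simp [hempty]
    · rw [← hexp]
      exact measure_add_lt_integral_le_exp D (hfm s) (by positivity) (hfM s hs) hn
        (Real.sqrt_nonneg _)
  rw [tsub_le_iff_right]
  set A : Set (Fin n → (Fin B → ℝ) × ℝ) := {S | ∀ s : Finset (Fin B), s.Nonempty → s.card ≤ K →
    ∫ p, f s p ∂D ≤ (n : ℝ)⁻¹ * ∑ i, f s (S i) + M ^ 2 * t} with hA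
  have hAc : (Measure.pi fun _ : Fin n => D) Aᶜ ≤ ENNReal.ofReal δ := by
    calc _ ≤ (Measure.pi fun _ : Fin n => D) (⋃ s ∈ T,
          {S | (n : ℝ)⁻¹ * ∑ i, f s (S i) + M ^ 2 * t < ∫ p, f s p ∂D}) := by
          refine measure_mono fun S hS => ?_
          simp only [hA, Set.mem_compl_iff, Set.mem_ofPred_eq, not_forall, not_le] at hS
          obtain ⟨s, hs, hsK, h⟩ := hS
          exact Set.mem_biUnion (show s ∈ T by simp [hT, hs, hsK]) h
      _ ≤ ∑ s ∈ T, ENNReal.ofReal (δ / ((B : ℝ) ^ K / (K - 1).factorial)) :=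
          (measure_biUnion_finset_le _ _).trans (Finset.sum_le_sum hbad)
      _ ≤ ENNReal.ofReal δ := by
          rw [Finset.sum_const, ← ENNReal.ofReal_nsmul, nsmul_eq_mul]
          refine ENNReal.ofReal_le_ofReal ?_
          rw [mul_div_left_comm]
          exact mul_le_of_le_one_right hδ.le (div_le_one_of_le₀ hTcard (by positivity))
  calc (1 : ENNReal) = (Measure.pi fun _ : Fin n => D) (A ∪ Aᶜ) := by simp
    _ ≤ _ := (measure_union_le _ _).trans (by gcongr)
end

section
/- Let 𝒳 ⊆ ℝ^B, with B even, be the set of vectors of predictions of the label of an observation by a forest of B trees, 𝒴 ⊆ ℝ bounded with M = sup 𝒴 − inf 𝒴 finite, and assume |h(x) − y| ≤ M for all relevant h, x, y. Let ℋ = {x ∈ 𝒳 ↦ w·(e·x) : w ∈ {1, 1/2, …, 1/B}, e ∈ {0,1}^B, Σ_{i=1}^B e_i = 1/w} (equally weighted averages over any non-empty subset of the trees). Let S be an i.i.d. sample of size n from a distribution 𝒟 over 𝒳 × 𝒴. Then for any δ > 0, with probability at least 1 − δ, every h ∈ ℋ satisfies R(h) ≤ R̂_S(h) + M²·√(((B/2)·log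 B + log(1/(δ·(B/2 − 1)!)) + log 2)/(2n)), where R and R̂_S are the generalization and empirical risks under the squared loss. -/
open MeasureTheory

open ProbabilityTheory in
/-- **One-sided Hoeffding bound** for the empirical mean of a nonnegative bounded function over an
i.i.d. sample. -/
lemma measureReal_empiricalMean_add_lt_integral_le {α : Type*} [MeasurableSpace α] (D : Measure α)
    [IsProbabilityMeasure D] {n : ℕ} (hn : 0 < n) {f : α → ℝ} (hf : Measurable f)
    (hf0 : ∀ x, 0 ≤ f x) {c : ℝ} (hc : 0 ≤ c) (hfc : ∀ᵐ x ∂D, f x ≤ c) {L : ℝ} (hL : 0 ≤ L) :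
    (Measure.pi fun _ : Fin n => D).real
      {S | (n : ℝ)⁻¹ * ∑ i, f (S i) + c * √(L / (2 * n)) < ∫ x, f x ∂D} ≤ Real.exp (-L) := by
  have hn' : (0 : ℝ) < n := by exact_mod_cast hn
  rcases hc.eq_or_lt with rfl | hc
  · have hint : ∫ x, f x ∂D ≤ 0 := integral_nonpos_of_ae hfc
    have hempty : {S : Fin n → α | (n : ℝ)⁻¹ * ∑ i, f (S i) + 0 * √(L / (2 * n)) < ∫ x, f x ∂D}
        = ∅ := by
      refine Set.eq_empty_of_forall_notMem fun S hS => ?_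
      have hsum : 0 ≤ (n : ℝ)⁻¹ * ∑ i, f (S i) :=
        mul_nonneg (by positivity) (Finset.sum_nonneg fun i _ => hf0 (S i))
      simp only [Set.mem_ofPred_eq, zero_mul, add_zero] at hS
      linarith
    rw [hempty, measureReal_empty]
    positivity
  · have hsub : HasSubgaussianMGF (fun x => ∫ y, f y ∂D - f x) ((‖c - 0‖₊ / 2) ^ 2) D := by
      have h := (hasSubgaussianMGF_of_mem_Icc (μ := D) (a := 0) (b := c) hf.aemeasurable
        (by filter_upwards [hfc] with x hx using ⟨hf0 x, hx⟩)).neg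
      convert h using 1
      ext x
      simp
    have hsub' (i : Fin n) : HasSubgaussianMGF (fun S : Fin n → α => ∫ y, f y ∂D - f (S i))
        ((‖c - 0‖₊ / 2) ^ 2) (Measure.pi fun _ : Fin n => D) := by
      refine HasSubgaussianMGF.of_map (Y := fun S : Fin n → α => S i)
        (X := fun x => ∫ y, f y ∂D - f x) (measurable_pi_apply i).aemeasurable ?_
      rwa [(measurePreserving_eval (fun _ : Fin n => D) i).map_eq]
    have hind : iIndepFun (fun i (S : Fin n → α) => ∫ y, f y ∂D - f (S i))
        (Measure.pi fun _ : Fin n => D) :=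
      iIndepFun_pi (X := fun _ x => ∫ y, f y ∂D - f x) fun _ => (hf.const_sub _).aemeasurable
    have hε : 0 ≤ n * (c * √(L / (2 * n))) := by positivity
    have key := HasSubgaussianMGF.measure_sum_ge_le_of_iIndepFun hind (s := Finset.univ)
      (fun i _ => hsub' i) hε
    have hexp : -(n * (c * √(L / (2 * n)))) ^ 2 /
        (2 * ((∑ _i : Fin n, (‖c - 0‖₊ / 2) ^ 2 : NNReal) : ℝ)) = -L := by
      have hsq : √(L / (2 * n)) ^ 2 = L / (2 * n) := Real.sq_sqrt (by positivity)
      have hcn : |c| = c := abs_of_pos hc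
      rw [mul_pow, mul_pow, hsq]
      simp [hcn]
      field_simp
    push_cast at key hexp
    rw [hexp] at key
    refine (measureReal_mono fun S hS => ?_).trans key
    simp only [Set.mem_ofPred_eq, Finset.sum_sub_distrib, Finset.sum_const, Finset.card_univ,
      Fintype.card_fin, nsmul_eq_mul] at hS ⊢
    have h := mul_lt_mul_of_pos_left hS hn'
    rw [mul_add, mul_inv_cancel_left₀ hn'.ne'] at h
    linarith

/-- Generalization bound for a finite class of nonnegative bounded losses, by Hoeffding's inequality
and a union bound. -/
lemma one_sub_ofReal_le_measure_forall_integral_le {α ι : Type*} [MeasurableSpace α]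
    (D : Measure α) [IsProbabilityMeasure D] {n : ℕ} (hn : 0 < n) (T : Finset ι) {f : ι → α → ℝ}
    (hf : ∀ t, Measurable (f t)) (hf0 : ∀ t x, 0 ≤ f t x) {c : ℝ} (hc : 0 ≤ c)
    (hfc : ∀ t ∈ T, ∀ᵐ x ∂D, f t x ≤ c) {L δ : ℝ} (hL : 0 ≤ L) (hδ : T.card * Real.exp (-L) ≤ δ) :
    1 - ENNReal.ofReal δ ≤ (Measure.pi fun _ : Fin n => D)
      {S | ∀ t ∈ T, ∫ x, f t x ∂D ≤ (n : ℝ)⁻¹ * ∑ i, f t (S i) + c * √(L / (2 * n))} := by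
  set μ := Measure.pi fun _ : Fin n => D
  set A : Set (Fin n → α) :=
    {S | ∀ t ∈ T, ∫ x, f t x ∂D ≤ (n : ℝ)⁻¹ * ∑ i, f t (S i) + c * √(L / (2 * n))} with hA
  have hcompl : Aᶜ = ⋃ t ∈ T,
      {S | (n : ℝ)⁻¹ * ∑ i, f t (S i) + c * √(L / (2 * n)) < ∫ x, f t x ∂D} := by
    ext S
    simp [hA]
  have hbad : μ.real Aᶜ ≤ δ := by
    rw [hcompl]
    refine (measureReal_biUnion_finset_le _ _).trans (le_trans ?_ hδ)
    rw [← nsmul_eq_mul]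
    exact Finset.sum_le_card_nsmul _ _ _ fun t ht =>
      measureReal_empiricalMean_add_lt_integral_le D hn (hf t) (hf0 t) hc (hfc t ht) hL
  have hbad' : μ Aᶜ ≤ ENNReal.ofReal δ := by
    rw [← ofReal_measureReal]
    exact ENNReal.ofReal_le_ofReal hbad
  rw [tsub_le_iff_right]
  calc (1 : ENNReal) = μ Set.univ := measure_univ.symm
    _ ≤ μ A + μ Aᶜ := by
      rw [← Set.union_compl_self A]
      exact measure_union_le _ _
    _ ≤ μ A + ENNReal.ofReal δ := by gcongr

lemma Nat.two_mul_pow_self_le_succ_pow {m : ℕ} (hm : 0 < m) : 2 * m ^ m ≤ (m + 1) ^ m := by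
  have hm' : (0 : ℝ) < m := by exact_mod_cast hm
  have h := one_add_mul_le_pow (a := (m : ℝ)⁻¹) (by linarith [inv_pos.mpr hm']) m
  rw [mul_inv_cancel₀ hm'.ne'] at h
  have h2 : (2 : ℝ) * m ^ m ≤ (m + 1) ^ m := by
    calc (2 : ℝ) * m ^ m ≤ (1 + (m : ℝ)⁻¹) ^ m * m ^ m := by gcongr; linarith
      _ = (m + 1) ^ m := by
        rw [← mul_pow, add_mul, inv_mul_cancel₀ hm'.ne', one_mul]
  exact_mod_cast h2

lemma Nat.two_pow_mul_factorial_le_succ_pow (j : ℕ) : 2 ^ j * j.factorial ≤ (j + 1) ^ j := by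
  induction j with
  | zero => simp
  | succ j ih =>
    calc 2 ^ (j + 1) * (j + 1).factorial = 2 * ((j + 1) * (2 ^ j * j.factorial)) := by
          rw [Nat.factorial_succ]; ring
      _ ≤ 2 * ((j + 1) * (j + 1) ^ j) := by gcongr
      _ = 2 * (j + 1) ^ (j + 1) := by ring
      _ ≤ (j + 1 + 1) ^ (j + 1) := Nat.two_mul_pow_self_le_succ_pow j.succ_pos

lemma Nat.two_pow_mul_factorial_half_pred_le {B : ℕ} (hBpos : 0 < B) (hBeven : Even B) :
    2 ^ B * (B / 2 - 1).factorial ≤ 2 * B ^ (B / 2) := by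
  obtain ⟨k, rfl⟩ := hBeven
  obtain ⟨j, rfl⟩ : ∃ j, k = j + 1 := ⟨k - 1, by omega⟩
  have hhalf : (j + 1 + (j + 1)) / 2 = j + 1 := by omega
  rw [hhalf, Nat.add_sub_cancel]
  calc 2 ^ (j + 1 + (j + 1)) * j.factorial = 2 ^ (j + 2) * (2 ^ j * j.factorial) := by ring
    _ ≤ 2 ^ (j + 2) * (j + 1) ^ j := by gcongr; exact Nat.two_pow_mul_factorial_le_succ_pow j
    _ ≤ 2 ^ (j + 2) * (j + 1) ^ (j + 1) := by gcongr <;> omega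
    _ = 2 * (j + 1 + (j + 1)) ^ (j + 1) := by
      rw [← two_mul, mul_pow]; ring

/-- generalization bound for SFS/SBS'-pruned regression forests.  The hypothesis
class consists of the equally weighted averages over arbitrary nonempty subsets `s` of the `B`
trees (`B` even), `x ↦ (1/|s|)∑_{i∈s} x_i`.  With labels in a bounded set `𝒴` of diameter
`M = sup 𝒴 − inf 𝒴` and squared losses bounded by `M²`, for any `δ > 0`, with probability
at least `1 − δ` over the i.i.d. sample of size `n`, every such hypothesis satisfies
`R(h) ≤ R̂_S(h) + M²√(((B/2)log B + log(1/(δ(B/2−1)!)) + log 2)/(2n))`. -/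
theorem stmt6 (B n : ℕ) (hBpos : 0 < B) (hBeven : Even B) (hn : 0 < n)
    (𝒴 : Set ℝ) (hYne : 𝒴.Nonempty) (hbddA : BddAbove 𝒴) (hbddB : BddBelow 𝒴)
    (M : ℝ) (hM : M = sSup 𝒴 - sInf 𝒴)
    (D : Measure ((Fin B → ℝ) × ℝ)) [IsProbabilityMeasure D]
    (hDY : ∀ᵐ p ∂D, p.2 ∈ 𝒴)
    (hbound : ∀ᵐ p ∂D, ∀ s : Finset (Fin B), s.Nonempty →
      |(s.card : ℝ)⁻¹ * ∑ i ∈ s, p.1 i - p.2| ≤ M)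
    (δ : ℝ) (hδ : 0 < δ) :
    1 - ENNReal.ofReal δ ≤
      (Measure.pi fun _ : Fin n => D) {S : Fin n → (Fin B → ℝ) × ℝ |
        ∀ s : Finset (Fin B), s.Nonempty →
          ∫ p, ((s.card : ℝ)⁻¹ * ∑ i ∈ s, p.1 i - p.2) ^ 2 ∂D ≤
            (n : ℝ)⁻¹ * ∑ i, ((s.card : ℝ)⁻¹ * ∑ j ∈ s, (S i).1 j - (S i).2) ^ 2 +
              M ^ 2 * Real.sqrt
                ((((B / 2 : ℕ) : ℝ) * Real.log B +
                    Real.log (1 / (δ * (Nat.factorial (B / 2 - 1)))) + Real.log 2) /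
                  (2 * n))} := by
  rcases le_or_gt 1 δ with hδ1 | hδ1
  · rw [tsub_eq_zero_of_le (by simpa using hδ1)]
    exact zero_le
  have hBr : (0 : ℝ) < B := by exact_mod_cast hBpos
  have hfac : (0 : ℝ) < (B / 2 - 1).factorial := by exact_mod_cast Nat.factorial_pos _
  set L : ℝ := ((B / 2 : ℕ) : ℝ) * Real.log B +
    Real.log (1 / (δ * (Nat.factorial (B / 2 - 1)))) + Real.log 2 with hLdef
  have hexp : Real.exp (-L) = δ * (B / 2 - 1).factorial / (2 * (B : ℝ) ^ (B / 2)) := by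
    rw [Real.exp_neg, hLdef, Real.exp_add, Real.exp_add, Real.exp_log (by positivity),
      Real.exp_log (by positivity), ← Real.log_pow, Real.exp_log (by positivity)]
    field_simp
  have hcount : (2 : ℝ) ^ B * (B / 2 - 1).factorial ≤ 2 * (B : ℝ) ^ (B / 2) := by
    exact_mod_cast Nat.two_pow_mul_factorial_half_pred_le hBpos hBeven
  have hcard : (2 : ℝ) ^ B * Real.exp (-L) ≤ δ := by
    rw [hexp, ← mul_div_assoc, div_le_iff₀ (by positivity)]
    nlinarith
  have hL : 0 ≤ L := by
    have h2 : (1 : ℝ) ≤ 2 ^ B := one_le_pow₀ one_le_two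
    have h : Real.exp (-L) ≤ 1 := by nlinarith [Real.exp_pos (-L)]
    linarith [Real.exp_le_one_iff.mp h]
  have h := one_sub_ofReal_le_measure_forall_integral_le D hn
    (Finset.univ.filter fun s : Finset (Fin B) => s.Nonempty)
    (f := fun s p => ((s.card : ℝ)⁻¹ * ∑ i ∈ s, p.1 i - p.2) ^ 2)
    (fun s => by fun_prop) (fun s p => sq_nonneg _) (sq_nonneg M)
    (fun s hs => by
      filter_upwards [hbound] with p hp
      exact sq_le_sq.mpr ((hp s (Finset.mem_filter.mp hs).2).trans (le_abs_self M)))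
    hL (δ := δ) (by
      refine le_trans ?_ hcard
      gcongr
      exact_mod_cast (Finset.card_filter_le _ _).trans (by simp))
  simpa using h
end
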